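/- Suppose X₁,…,X_m are η-coplanar. Then for every unit vector θ in the cone C_X, γ(θ) = ⟨θ, η⟩ · sup{ h(p) : p a probability vector with p₁X₁ + ⋯ + p_mX_m = θ/⟨θ, η⟩ }. -/

import Mathlib

open scoped BigOperators RealInnerProductSpace
open Filter Topology

noncomputable section

/-- `Euc s` is the Euclidean space `ℝ^s`. -/
abbrev Euc (s : ℕ) := EuclideanSpace ℝ (Fin s)

/-- The additive semigroup `X₁ℕ + ⋯ + X_mℕ` generated by the vectors `X j`. -/
def sgOf {s : ℕ} {ι : Type*} [Fintype ι] (X : ι → Euc s) : Set (Euc s) :=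
  {z | ∃ u : ι → ℕ, ∑ j, (u j : ℝ) • X j = z}

/-- The lattice `X₁ℤ + ⋯ + X_mℤ` generated by the vectors `X j`. -/
def latOf {s : ℕ} {ι : Type*} [Fintype ι] (X : ι → Euc s) : Set (Euc s) :=
  {z | ∃ u : ι → ℤ, ∑ j, (u j : ℝ) • X j = z}

/-- The convex cone `X₁ℝ⁺ + ⋯ + X_mℝ⁺` generated by the vectors `X j`. -/
def coneOf {s : ℕ} {ι : Type*} [Fintype ι] (X : ι → Euc s) : Set (Euc s) :=
  {x | ∃ c : ι → ℝ, (∀ j, 0 ≤ c j) ∧ ∑ j, c j • X j = x}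

/-- The multiplicity of `z`: the number of finite words `i₁…i_n` with
`X_{i₁} + ⋯ + X_{i_n} = z`. -/
def mult {s : ℕ} {ι : Type*} [Fintype ι] (X : ι → Euc s) (z : Euc s) : ℕ :=
  Set.ncard {w : List ι | (w.map X).sum = z}

/-- The multiplicity extended to the cone: the minimum of `mult X z` over points
`z` of the semigroup nearest to `x`. -/
def multC {s : ℕ} {ι : Type*} [Fintype ι] (X : ι → Euc s) (x : Euc s) : ℕ :=
  sInf {n | ∃ z ∈ sgOf X, dist x z = Metric.infDist x (sgOf X) ∧ mult X z = n}

/-- All the vectors `X j` have integer coordinates. -/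
def IntegralVecs {s : ℕ} {ι : Type*} (X : ι → Euc s) : Prop :=
  ∀ j i, ∃ n : ℤ, X j i = (n : ℝ)

/-- The entropy `h(p) = -∑ p_j log p_j` of a probability vector. -/
def entropy {m : ℕ} (p : Fin m → ℝ) : ℝ := -∑ j, p j * Real.log (p j)

/-- The `p`-th iteration of `X`: all sums `X_{ω₁} + ⋯ + X_{ω_p}` over words `ω`. -/
def iter {s m : ℕ} (X : Fin m → Euc s) (p : ℕ) : (Fin p → Fin m) → Euc s :=
  fun ω => ∑ i, X (ω i)

theorem count_ofFn {m : ℕ} (j : Fin m) : ∀ (n : ℕ) (f : Fin n → Fin m),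
    (List.ofFn f).count j = ∑ i, if f i = j then 1 else 0 := by
  intro n
  induction n with
  | zero => intro f; simp
  | succ n ih =>
    intro f
    rw [List.ofFn_succ, List.count_cons, Fin.sum_univ_succ, ih, add_comm]
    simp

theorem count_fun {m n : ℕ} (u : Fin m → ℕ) (hu : ∑ j, u j = n) :
    (Finset.univ.filter (fun f : Fin n → Fin m =>
      ∀ j, (List.ofFn f).count j = u j)).card = Nat.multinomial Finset.univ u := by
  have h1 : ((∑ j : Fin m, (MvPolynomial.X j : MvPolynomial (Fin m) ℕ)) ^ n) =
    ∑ f : Fin n → Fin m, MvPolynomial.monomial (∑ i, Finsupp.single (f i) 1) 1 := by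
    rw [Fintype.sum_pow]
    refine Finset.sum_congr rfl fun f _ => ?_
    rw [MvPolynomial.monomial_sum_one]
    rfl
  have h2 := Finset.sum_pow_eq_sum_piAntidiag Finset.univ
    (fun j : Fin m => (MvPolynomial.X j : MvPolynomial (Fin m) ℕ)) n
  rw [h1] at h2
  have h3 := congrArg (MvPolynomial.coeff (Finsupp.equivFunOnFinite.symm u)) h2
  rw [MvPolynomial.coeff_sum, MvPolynomial.coeff_sum] at h3
  have e1 : ∀ k : Fin m → ℕ, (∏ i, (MvPolynomial.X i : MvPolynomial (Fin m) ℕ) ^ k i)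
      = MvPolynomial.monomial (Finsupp.equivFunOnFinite.symm k) 1 := by
    intro k
    rw [MvPolynomial.monomial_eq]
    simp [Finsupp.prod_fintype]
  have e2 : ∀ k : Fin m → ℕ, MvPolynomial.coeff (Finsupp.equivFunOnFinite.symm u)
      ((Nat.multinomial Finset.univ k : MvPolynomial (Fin m) ℕ) *
        ∏ i, (MvPolynomial.X i : MvPolynomial (Fin m) ℕ) ^ k i)
      = if k = u then Nat.multinomial Finset.univ u else 0 := by
    intro k
    rw [e1, ← MvPolynomial.C_eq_coe_nat, MvPolynomial.coeff_C_mul, MvPolynomial.coeff_monomial]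
    by_cases h : k = u
    · simp [h]
    · simp [h]
  rw [Finset.sum_congr rfl (fun k _ => e2 k)] at h3
  simp only [MvPolynomial.coeff_monomial] at h3
  rw [Finset.sum_ite_eq', if_pos (by simp [hu]), ← Finset.card_filter] at h3
  rw [← h3]
  congr 1
  ext f
  simp only [Finset.mem_filter, Finset.mem_univ, true_and, Finsupp.ext_iff]
  refine forall_congr' fun j => ?_
  rw [count_ofFn, Finset.sum_apply']
  simp [Finsupp.single_apply]

theorem count_list {m : ℕ} (u : Fin m → ℕ) :
    {w : List (Fin m) | ∀ j, w.count j = u j}.Finite ∧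
    {w : List (Fin m) | ∀ j, w.count j = u j}.ncard = Nat.multinomial Finset.univ u := by
  have hE : {w : List (Fin m) | ∀ j, w.count j = u j} =
    List.ofFn '' ((Finset.univ.filter (fun f : Fin (∑ j, u j) → Fin m =>
      ∀ j, (List.ofFn f).count j = u j) : Finset _) : Set (Fin (∑ j, u j) → Fin m)) := by
    ext w
    simp only [Set.mem_ofPred_eq, Set.mem_image, Finset.coe_filter, Finset.mem_univ, true_and]
    constructor
    · intro h
      have hl : w.length = ∑ j, u j := by
        simp only [← h]
        have := Multiset.sum_count_eq_card (s := Finset.univ) (m := (w : Multiset (Fin m)))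
          (fun a _ => Finset.mem_univ a)
        simpa using this.symm
      refine ⟨fun i => w.get (i.cast hl.symm), ?_, ?_⟩
      · rw [show List.ofFn (fun i => w.get (Fin.cast hl.symm i)) = w from ?_]
        · exact h
        · apply List.ext_get <;> simp [hl]
      · apply List.ext_get <;> simp [hl]
    · rintro ⟨f, hf, rfl⟩
      exact hf
  rw [hE]
  refine ⟨(Finset.finite_toSet _).image _, ?_⟩
  rw [Set.ncard_image_of_injective _ List.ofFn_injective, Set.ncard_coe_finset, count_fun u rfl]

theorem fact_lower (n : ℕ) : (n:ℝ) * Real.log n - n ≤ Real.log (n.factorial) := by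
  rcases Nat.eq_zero_or_pos n with rfl | hn
  · simp
  have h := Real.pow_div_factorial_le_exp (n:ℝ) (by positivity) n
  have h2 := Real.log_le_log (by positivity) h
  rw [Real.log_exp, Real.log_div (by positivity) (by positivity), Real.log_pow] at h2
  linarith

theorem fact_upper (n : ℕ) : Real.log (n.factorial) ≤ ((n:ℝ)+1) * Real.log (n+1) - n := by
  induction n with
  | zero => simp
  | succ n ih =>
    rw [Nat.factorial_succ]
    push_cast
    rw [Real.log_mul (by positivity) (by positivity)]
    have h : 1 - ((n:ℝ)+2)/(n+1) ≤ 0 := by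
      rw [sub_nonpos, le_div_iff₀ (by positivity)]; linarith
    have h1 := Real.log_le_sub_one_of_pos (x := ((n:ℝ)+1)/(n+2)) (by positivity)
    rw [Real.log_div (by positivity) (by positivity)] at h1
    have h2 : ((n:ℝ)+2) * (((n:ℝ)+1)/(n+2) - 1) = -1 := by field_simp; ring
    have h3 := mul_le_mul_of_nonneg_left h1 (show (0:ℝ) ≤ n + 2 by positivity)
    rw [h2] at h3
    rw [show (n:ℝ)+1+1 = n+2 by ring]
    nlinarith

theorem log_div_zero (φ : ℕ → ℕ) (hφ : Tendsto φ atTop atTop) :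
    Tendsto (fun k => Real.log (φ k) / (φ k : ℝ)) atTop (𝓝 0) := by
  have h := Real.isLittleO_log_id_atTop.tendsto_div_nhds_zero
  exact h.comp (tendsto_natCast_atTop_atTop.comp hφ)

theorem xlog_aux (φ : ℕ → ℕ) (v : ℕ → ℝ) (x : ℝ)
    (h : Tendsto (fun k => v k / φ k) atTop (𝓝 x)) :
    Tendsto (fun k => v k / φ k * Real.log (v k / φ k)) atTop (𝓝 (x * Real.log x)) :=
  (Real.continuous_mul_log.tendsto x).comp h

theorem fact_asymp (φ : ℕ → ℕ) (hφ : Tendsto φ atTop atTop) (u : ℕ → ℕ) (x : ℝ)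
    (h : Tendsto (fun k => (u k : ℝ) / φ k) atTop (𝓝 x)) :
    Tendsto (fun k => (Real.log ((u k).factorial) - u k * Real.log (φ k)) / φ k) atTop
      (𝓝 (x * Real.log x - x)) := by
  have hφR : Tendsto (fun k => (φ k : ℝ)) atTop atTop := tendsto_natCast_atTop_atTop.comp hφ
  have hinv : Tendsto (fun k => 1 / (φ k : ℝ)) atTop (𝓝 0) := by
    simp only [one_div]
    exact hφR.inv_tendsto_atTop
  have h' : Tendsto (fun k => ((u k : ℝ) + 1) / φ k) atTop (𝓝 x) := by
    have := h.add hinv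
    simp only [add_zero] at this
    exact this.congr fun k => by ring
  have hpos : ∀ᶠ k in atTop, 0 < (φ k : ℝ) := hφR.eventually_gt_atTop 0
  have hl := (xlog_aux φ _ x h).sub h
  have hr := ((xlog_aux φ _ x h').sub h).add (log_div_zero φ hφ)
  rw [add_zero] at hr
  refine tendsto_of_tendsto_of_tendsto_of_le_of_le' hl hr ?_ ?_
  · filter_upwards [hpos] with k hk
    rw [le_div_iff₀ hk]
    have e := fact_lower (u k)
    rcases Nat.eq_zero_or_pos (u k) with h0 | h0
    · simp [h0]
    · rw [Real.log_div (by positivity) (by positivity)]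
      have : (↑(u k) / ↑(φ k) * (Real.log ↑(u k) - Real.log ↑(φ k)) - ↑(u k) / (φ k:ℝ)) * ↑(φ k)
        = u k * Real.log (u k) - u k * Real.log (φ k) - u k := by field_simp
      rw [this]; linarith
  · filter_upwards [hpos] with k hk
    rw [div_le_iff₀ hk]
    have e := fact_upper (u k)
    rw [Real.log_div (by positivity) (by positivity)]
    have : ((↑(u k) + 1) / ↑(φ k) * (Real.log (↑(u k) + 1) - Real.log ↑(φ k)) - ↑(u k) / ↑(φ k) +
      Real.log ↑(φ k) / ↑(φ k)) * (φ k : ℝ)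
        = (u k + 1) * Real.log (u k + 1) - u k * Real.log (φ k) - u k := by field_simp; ring
    rw [this]; linarith

/-- limit functional -/
def GG {m : ℕ} (x : Fin m → ℝ) : ℝ :=
  (∑ j, x j) * Real.log (∑ j, x j) - ∑ j, x j * Real.log (x j)

theorem GG_cont {m : ℕ} : Continuous (GG (m := m)) := by
  unfold GG
  refine Continuous.sub ?_ ?_
  · exact Real.continuous_mul_log.comp (by fun_prop)
  · exact continuous_finsetSum _ fun j _ => Real.continuous_mul_log.comp (by fun_prop)

theorem GG_smul {m : ℕ} (a : ℝ) (ha : 0 < a) (p : Fin m → ℝ) (hp : ∑ j, p j = 1) :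
    GG (fun j => a * p j) = a * (-∑ j, p j * Real.log (p j)) := by
  unfold GG
  have : ∀ j, a * p j * Real.log (a * p j) = a * Real.log a * p j + a * (p j * Real.log (p j)) := by
    intro j
    by_cases h : p j = 0
    · simp [h]
    · rw [Real.log_mul ha.ne' h]; ring
  simp only [this, Finset.sum_add_distrib, ← Finset.mul_sum, hp]
  simp

theorem multinomial_asymp {m : ℕ} (φ : ℕ → ℕ) (hφ : Tendsto φ atTop atTop) (u : ℕ → Fin m → ℕ)
    (x : Fin m → ℝ)
    (h : ∀ j, Tendsto (fun k => (u k j : ℝ) / φ k) atTop (𝓝 (x j))) :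
    Tendsto (fun k => Real.log (Nat.multinomial Finset.univ (u k)) / φ k) atTop (𝓝 (GG x)) := by
  have hs : Tendsto (fun k => ((∑ j, u k j : ℕ) : ℝ) / φ k) atTop (𝓝 (∑ j, x j)) := by
    have := tendsto_finsetSum Finset.univ fun j _ => h j
    refine this.congr fun k => ?_
    push_cast
    rw [Finset.sum_div]
  have h1 := fact_asymp φ hφ _ _ hs
  have h2 := tendsto_finsetSum Finset.univ fun j _ => fact_asymp φ hφ _ _ (h j)
  have h3 := h1.sub h2
  rw [show (∑ j, x j) * Real.log (∑ j, x j) - (∑ j, x j) -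
    ∑ i, (x i * Real.log (x i) - x i) = GG x by
      unfold GG; rw [Finset.sum_sub_distrib]; ring] at h3
  refine h3.congr fun k => ?_
  have e := Nat.multinomial_spec Finset.univ (u k)
  have e2 := congrArg (fun n : ℕ => Real.log (n : ℝ)) e
  push_cast at e2
  rw [Real.log_mul (by positivity) (by
    have := Nat.multinomial_pos Finset.univ (u k); positivity),
    Real.log_prod (by intros; positivity)] at e2
  rw [← Finset.sum_div, ← sub_div, ← e2, Finset.sum_sub_distrib, ← Finset.sum_mul]
  push_cast
  congr 1; ring

theorem int_kernel {m s : ℕ} (A : Fin m → Fin s → ℤ) (κ : Fin m → ℝ)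
    (h : ∀ i, ∑ j, κ j * (A j i : ℝ) = 0) :
    ∃ (n : ℕ) (r : Fin n → ℝ) (K : Fin n → Fin m → ℤ),
      (∀ j, κ j = ∑ l, r l * K l j) ∧ (∀ l i, ∑ j, K l j * A j i = 0) ∧
      (∀ j, κ j = 0 → ∀ l, K l j = 0) := by
  let W : Submodule ℤ ℝ := Submodule.span ℤ (Set.range κ)
  have : Module.Finite ℤ W := Module.Finite.span_of_finite ℤ (Set.finite_range κ)
  have : Module.Free ℤ W := inferInstance
  let b := Module.finBasis ℤ W
  let k : Fin m → W := fun j => ⟨κ j, Submodule.subset_span ⟨j, rfl⟩⟩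
  refine ⟨_, fun l => (b l : ℝ), fun l j => b.repr (k j) l, ?_, ?_, ?_⟩
  · intro j
    have := congrArg (fun w : W => (w : ℝ)) (b.sum_repr (k j))
    simp only [Submodule.coe_sum, Submodule.coe_smul, zsmul_eq_mul] at this
    rw [show κ j = (k j : ℝ) from rfl, ← this]
    exact Finset.sum_congr rfl fun _ _ => mul_comm _ _
  · intro l i
    have h0 : ∑ j, A j i • k j = 0 := by
      apply Subtype.ext
      simp only [Submodule.coe_sum, Submodule.coe_smul, zsmul_eq_mul, Submodule.coe_zero]
      rw [← h i]
      exact Finset.sum_congr rfl fun _ _ => mul_comm _ _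
    have := congrArg (fun w => b.repr w l) h0
    simp only [map_sum, map_smul, map_zero, Finsupp.coe_finsetSum, Finset.sum_apply,
      Finsupp.smul_apply, smul_eq_mul, Finsupp.zero_apply] at this
    rw [← this]
    exact Finset.sum_congr rfl fun _ _ => mul_comm _ _
  · intro j hj l
    have : k j = 0 := Subtype.ext hj
    simp [this]

theorem word_sum {s m : ℕ} (X : Fin m → Euc s) (w : List (Fin m)) :
    (w.map X).sum = ∑ j, ((w.count j : ℕ) : ℝ) • X j := by
  induction w with
  | nil => simp
  | cons a w ih =>
    rw [List.map_cons, List.sum_cons, ih]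
    simp only [List.count_cons, Nat.cast_add, add_smul, Finset.sum_add_distrib]
    rw [add_comm]
    congr 1
    simp

theorem inner_rep {s m : ℕ} (X : Fin m → Euc s) (η : Euc s) (hη : ∀ j, ⟪η, X j⟫ = 1)
    (c : Fin m → ℝ) : ⟪η, ∑ j, c j • X j⟫ = ∑ j, c j := by
  rw [inner_sum]
  simp [inner_smul_right, hη]

theorem words_finite {s m : ℕ} (X : Fin m → Euc s) (η : Euc s) (hη : ∀ j, ⟪η, X j⟫ = 1)
    (z : Euc s) : {w : List (Fin m) | (w.map X).sum = z}.Finite := by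
  by_cases hne : ∃ w0 : List (Fin m), (w0.map X).sum = z
  · obtain ⟨w0, h0⟩ := hne
    have key : ∀ w : List (Fin m), ⟪η, (w.map X).sum⟫ = (w.length : ℝ) := by
      intro w
      induction w with
      | nil => simp
      | cons a w ih =>
        rw [List.map_cons, List.sum_cons, inner_add_right, ih, hη]
        push_cast [List.length_cons]; ring
    refine (List.finite_length_eq (Fin m) w0.length).subset ?_
    intro w hw
    have hw' : (w.map X).sum = z := hw
    have h1 := key w
    have h2 := key w0
    rw [hw'] at h1
    rw [h0, h1] at h2
    exact_mod_cast h2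
  · refine Set.finite_empty.subset ?_
    intro w hw
    exact hne ⟨w, hw⟩

theorem mult_lower {s m : ℕ} (X : Fin m → Euc s) (η : Euc s) (hη : ∀ j, ⟪η, X j⟫ = 1)
    (z : Euc s) (u : Fin m → ℕ) (hu : ∑ j, (u j : ℝ) • X j = z) :
    Nat.multinomial Finset.univ u ≤ mult X z := by
  rw [← (count_list u).2]
  refine Set.ncard_le_ncard ?_ (words_finite X η hη z)
  intro w hw
  have hw' : ∀ j, w.count j = u j := hw
  change (w.map X).sum = z
  rw [word_sum, ← hu]
  simp only [hw']

theorem mult_upper {s m : ℕ} (X : Fin m → Euc s) (η : Euc s) (hη : ∀ j, ⟪η, X j⟫ = 1)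
    (z : Euc s) (hz : z ∈ sgOf X) :
    ∃ u : Fin m → ℕ, ∑ j, (u j : ℝ) • X j = z ∧
      mult X z ≤ (∑ j, u j + 1) ^ m * Nat.multinomial Finset.univ u := by
  classical
  obtain ⟨u0, h0⟩ := hz
  have hsum : ∀ u : Fin m → ℕ, ∑ j, (u j : ℝ) • X j = z → ∑ j, u j = ∑ j, u0 j := by
    intro u hu
    have h1 := inner_rep X η hη (fun j => (u j : ℝ))
    have h2 := inner_rep X η hη (fun j => (u0 j : ℝ))
    rw [hu] at h1
    rw [h0, h1] at h2
    exact_mod_cast h2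
  set n := ∑ j, u0 j with hn
  let F : Finset (Fin m → ℕ) := (Fintype.piFinset fun _ => Finset.range (n+1)).filter
    (fun u => ∑ j, (u j : ℝ) • X j = z)
  have hF : ∀ u, u ∈ F ↔ ∑ j, (u j : ℝ) • X j = z := by
    intro u
    simp only [F, Finset.mem_filter, Fintype.mem_piFinset, Finset.mem_range]
    refine ⟨fun h => h.2, fun h => ⟨fun j => ?_, h⟩⟩
    have := hsum u h
    have h2 := Finset.single_le_sum (f := u) (fun i _ => Nat.zero_le _) (Finset.mem_univ j)
    omega
  obtain ⟨u, huF, hmax⟩ := Finset.exists_max_image F (Nat.multinomial Finset.univ) ⟨u0, (hF _).2 h0⟩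
  refine ⟨u, (hF _).1 huF, ?_⟩
  rw [hsum u ((hF _).1 huF)]
  have hcard : F.card ≤ (n+1)^m := by
    refine (Finset.card_filter_le _ _).trans ?_
    simp
  refine le_trans ?_ (Nat.mul_le_mul_right _ hcard)
  have hsub : {w : List (Fin m) | (w.map X).sum = z} ⊆
      ((F.biUnion fun v => (count_list v).1.toFinset : Finset (List (Fin m))) : Set (List (Fin m))) := by
    intro w hw
    have hw' : (w.map X).sum = z := hw
    simp only [Finset.coe_biUnion, Set.mem_iUnion, Set.Finite.coe_toFinset]
    refine ⟨fun j => w.count j, ?_, fun j => rfl⟩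
    rw [Finset.mem_coe, hF, ← hw', word_sum]
  refine (Set.ncard_le_ncard hsub (Finset.finite_toSet _)).trans ?_
  rw [Set.ncard_coe_finset]
  refine Finset.card_biUnion_le_card_mul _ _ _ fun v hv => ?_
  rw [← Set.ncard_eq_toFinset_card _ (count_list v).1, (count_list v).2]
  exact hmax v hv

theorem sg_closed {s m : ℕ} (X : Fin m → Euc s) (hint : IntegralVecs X) : IsClosed (sgOf X) := by
  refine Metric.isClosed_of_pairwise_le_dist (ε := 1) one_pos ?_
  have hI : ∀ z ∈ sgOf X, ∀ i, ∃ n : ℤ, z i = n := by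
    rintro z ⟨u, rfl⟩ i
    choose A hA using hint
    refine ⟨∑ j, (u j : ℤ) * A j i, ?_⟩
    simp [hA]
  intro x hx y hy hxy
  have : ∃ i, x i ≠ y i := by
    by_contra hcon
    push Not at hcon
    exact hxy (by ext i; exact hcon i)
  obtain ⟨i, hi⟩ := this
  obtain ⟨a, ha⟩ := hI x hx i
  obtain ⟨b, hb⟩ := hI y hy i
  have h1 : ‖(x - y) i‖ ≤ ‖x - y‖ := PiLp.norm_apply_le _ _
  rw [dist_eq_norm]
  refine le_trans ?_ h1
  rw [PiLp.sub_apply, ha, hb, Real.norm_eq_abs]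
  rw [ha, hb] at hi
  have hab : a ≠ b := fun h => hi (by rw [h])
  have : 1 ≤ |a - b| := Int.one_le_abs (sub_ne_zero.2 hab)
  exact_mod_cast this

theorem nearest {s m : ℕ} (X : Fin m → Euc s) (hint : IntegralVecs X) (x : Euc s) :
    ∃ z ∈ sgOf X, dist x z = Metric.infDist x (sgOf X) ∧ mult X z = multC X x := by
  have hne : (sgOf X).Nonempty := ⟨_, ⟨0, rfl⟩⟩
  obtain ⟨z, hz, hd⟩ := (sg_closed X hint).exists_infDist_eq_dist hne x
  have : {n | ∃ z ∈ sgOf X, dist x z = Metric.infDist x (sgOf X) ∧ mult X z = n}.Nonempty :=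
    ⟨_, z, hz, hd.symm, rfl⟩
  exact Nat.sInf_mem this

theorem infDist_bound {s m : ℕ} (X : Fin m → Euc s) (θ : Euc s) (hθc : θ ∈ coneOf X) (k : ℕ) :
    Metric.infDist ((k : ℝ) • θ) (sgOf X) ≤ ∑ j, ‖X j‖ := by
  obtain ⟨c, hc, rfl⟩ := hθc
  refine (Metric.infDist_le_dist_of_mem (y := ∑ j, ((⌊(k:ℝ) * c j⌋₊ : ℕ) : ℝ) • X j)
    (show _ ∈ sgOf X from ⟨fun j => ⌊(k:ℝ) * c j⌋₊, rfl⟩)).trans ?_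
  rw [dist_eq_norm, Finset.smul_sum, ← Finset.sum_sub_distrib]
  refine (norm_sum_le _ _).trans (Finset.sum_le_sum fun j _ => ?_)
  rw [smul_smul, ← sub_smul, norm_smul]
  have h0 : 0 ≤ (k:ℝ) * c j := mul_nonneg (Nat.cast_nonneg _) (hc j)
  have h1 := Nat.floor_le h0
  have h2 := Nat.lt_floor_add_one ((k:ℝ) * c j)
  have : ‖(k:ℝ) * c j - ((⌊(k:ℝ) * c j⌋₊ : ℕ) : ℝ)‖ ≤ 1 := by
    rw [Real.norm_eq_abs, abs_le]; constructor <;> linarith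
  exact mul_le_of_le_one_left (norm_nonneg _) this

theorem extract {s m : ℕ} (X : Fin m → Euc s) (η : Euc s) (hη : ∀ j, ⟪η, X j⟫ = 1)
    (θ : Euc s) (R : ℝ) (v : ℕ → Fin m → ℕ)
    (hv : ∀ k : ℕ, ‖∑ j, (v k j : ℝ) • X j - (k:ℝ) • θ‖ ≤ R) :
    ∃ (c : Fin m → ℝ) (φ : ℕ → ℕ), StrictMono φ ∧ (∀ j, 0 ≤ c j) ∧ ∑ j, c j • X j = θ ∧
      ∀ j, Tendsto (fun k => (v (φ k) j : ℝ) / φ k) atTop (𝓝 (c j)) := by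
  have hR : 0 ≤ R := (norm_nonneg _).trans (hv 0)
  let B : ℝ := ‖η‖ * (R + ‖θ‖)
  have hB : 0 ≤ B := by positivity
  have hmem : ∀ k, (fun j => (v k j : ℝ) / k) ∈ Set.Icc (0 : Fin m → ℝ) (fun _ => B) := by
    intro k
    refine ⟨fun j => by simp only [Pi.zero_apply]; positivity, fun j => ?_⟩
    rcases Nat.eq_zero_or_pos k with rfl | hk
    · simpa using hB
    have hk' : (1:ℝ) ≤ k := by exact_mod_cast hk
    change (v k j : ℝ) / k ≤ B
    rw [div_le_iff₀ (by positivity)]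
    have h1 : (v k j : ℝ) ≤ ∑ j, (v k j : ℝ) :=
      Finset.single_le_sum (f := fun j => (v k j : ℝ)) (fun i _ => Nat.cast_nonneg _) (Finset.mem_univ j)
    rw [← inner_rep X η hη] at h1
    have h2 := real_inner_le_norm η (∑ j, (v k j : ℝ) • X j)
    have h3 : ‖∑ j, (v k j : ℝ) • X j‖ ≤ R + k * ‖θ‖ := by
      have e := norm_add_le (∑ j, (v k j : ℝ) • X j - (k:ℝ) • θ) ((k:ℝ) • θ)
      rw [sub_add_cancel, norm_smul] at e
      have := hv k
      simp only [Real.norm_natCast] at e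
      linarith
    have h4 : R + k * ‖θ‖ ≤ (R + ‖θ‖) * k := by nlinarith
    have h5 := mul_le_mul_of_nonneg_left (h3.trans h4) (norm_nonneg η)
    simp only [B]
    linarith
  obtain ⟨c, hc, φ, hφ, hlim⟩ := isCompact_Icc.tendsto_subseq hmem
  have hlim' := tendsto_pi_nhds.1 hlim
  refine ⟨c, φ, hφ, fun j => hc.1 j, ?_, hlim'⟩
  have hφR : Tendsto (fun k => (φ k : ℝ)) atTop atTop :=
    tendsto_natCast_atTop_atTop.comp hφ.tendsto_atTop
  have t1 : Tendsto (fun k => ∑ j, ((v (φ k) j : ℝ) / φ k) • X j) atTop (𝓝 (∑ j, c j • X j)) :=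
    tendsto_finsetSum _ fun j _ => (hlim' j).smul_const _
  refine tendsto_nhds_unique t1 ?_
  rw [tendsto_iff_norm_sub_tendsto_zero]
  have hz : Tendsto (fun k => R / (φ k : ℝ)) atTop (𝓝 0) := hφR.const_div_atTop R
  refine squeeze_zero' (Eventually.of_forall fun _ => norm_nonneg _) ?_ hz
  filter_upwards [hφR.eventually_gt_atTop 0] with k hk
  have e : ∑ j, ((v (φ k) j : ℝ) / φ k) • X j - θ =
      (φ k : ℝ)⁻¹ • (∑ j, (v (φ k) j : ℝ) • X j - (φ k:ℝ) • θ) := by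
    rw [smul_sub, smul_smul, inv_mul_cancel₀ hk.ne', one_smul, Finset.smul_sum]
    congr 1
    refine Finset.sum_congr rfl fun j _ => ?_
    rw [smul_smul]; congr 1; ring
  rw [e, norm_smul, norm_inv, Real.norm_natCast, div_eq_inv_mul]
  exact mul_le_mul_of_nonneg_left (hv _) (by positivity)

theorem floor_lim (φ : ℕ → ℕ) (hφ : Tendsto φ atTop atTop) (r : ℝ) :
    Tendsto (fun k => ((⌊(φ k : ℝ) * r⌋ : ℤ) : ℝ) / φ k) atTop (𝓝 r) := by
  have hφR : Tendsto (fun k => (φ k : ℝ)) atTop atTop := tendsto_natCast_atTop_atTop.comp hφ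
  have hz : Tendsto (fun k => r - 1 / (φ k : ℝ)) atTop (𝓝 r) := by
    simpa using tendsto_const_nhds.sub (hφR.const_div_atTop (1:ℝ))
  refine tendsto_of_tendsto_of_tendsto_of_le_of_le' hz tendsto_const_nhds ?_ ?_
  · filter_upwards [hφR.eventually_gt_atTop 0] with k hk
    have := Int.lt_floor_add_one ((φ k : ℝ) * r)
    rw [le_div_iff₀ hk]
    have e : (r - 1 / (φ k : ℝ)) * φ k = φ k * r - 1 := by field_simp
    linarith
  · filter_upwards [hφR.eventually_gt_atTop 0] with k hk
    have := Int.floor_le ((φ k : ℝ) * r)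
    rw [div_le_iff₀ hk]; linarith

theorem shift {s m : ℕ} (X : Fin m → Euc s) (hint : IntegralVecs X)
    (φ : ℕ → ℕ) (hφ : Tendsto φ atTop atTop) (v : ℕ → Fin m → ℕ) (c x : Fin m → ℝ)
    (hv : ∀ j, Tendsto (fun k => (v k j : ℝ) / φ k) atTop (𝓝 (c j)))
    (hcx : ∑ j, c j • X j = ∑ j, x j • X j) (hx : ∀ j, 0 ≤ x j) (hxc : ∀ j, x j = 0 → c j = 0) :
    ∃ u : ℕ → Fin m → ℕ, (∀ j, Tendsto (fun k => (u k j : ℝ) / φ k) atTop (𝓝 (x j))) ∧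
      ∀ᶠ k in atTop, ∑ j, (u k j : ℝ) • X j = ∑ j, (v k j : ℝ) • X j := by
  have hφR : Tendsto (fun k => (φ k : ℝ)) atTop atTop := tendsto_natCast_atTop_atTop.comp hφ
  choose A hA using hint
  obtain ⟨n, r, K, h1, h2, h3⟩ := int_kernel A (fun j => c j - x j) (by
    intro i
    have := congrArg (fun z : Euc s => z i) hcx
    simp [hA] at this
    simp only [sub_mul, Finset.sum_sub_distrib, this, sub_self])
  let t : ℕ → Fin m → ℤ := fun k j => v k j - ∑ l, ⌊(φ k : ℝ) * r l⌋ * K l j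
  have ht : ∀ j, Tendsto (fun k => (t k j : ℝ) / φ k) atTop (𝓝 (x j)) := by
    intro j
    have e1 := (hv j).sub (tendsto_finsetSum Finset.univ fun l _ =>
      (floor_lim φ hφ (r l)).mul_const (K l j : ℝ))
    rw [← h1 j, sub_sub_cancel] at e1
    refine e1.congr fun k => ?_
    simp only [t]
    push_cast
    rw [sub_div, Finset.sum_div]
    congr 1
    refine Finset.sum_congr rfl fun l _ => ?_
    ring
  have hpos : ∀ᶠ k in atTop, ∀ j, 0 ≤ t k j := by
    rw [eventually_all]
    intro j
    rcases (hx j).eq_or_lt with h0 | h0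
    · have hK : ∀ l, K l j = 0 := h3 j (by simp [← h0, hxc j h0.symm])
      refine Eventually.of_forall fun k => ?_
      simp [t, hK]
    · filter_upwards [(ht j).eventually (lt_mem_nhds h0), hφR.eventually_gt_atTop 0] with k hk hk2
      have := (div_pos_iff_of_pos_right hk2).1 hk
      exact_mod_cast this.le
  refine ⟨fun k j => (t k j).toNat, fun j => ?_, ?_⟩
  · refine (ht j).congr' ?_
    filter_upwards [hpos] with k hk
    have : (((t k j).toNat : ℤ) : ℝ) = t k j := by rw [Int.toNat_of_nonneg (hk j)]
    rw [← this, Int.cast_natCast]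
  · filter_upwards [hpos] with k hk
    have e : ∀ j, (((t k j).toNat : ℕ) : ℝ) = t k j := by
      intro j
      have : (((t k j).toNat : ℤ) : ℝ) = t k j := by rw [Int.toNat_of_nonneg (hk j)]
      rw [← this, Int.cast_natCast]
    simp only [e]
    ext i
    have hz : ∑ j, (∑ l, ⌊(φ k : ℝ) * r l⌋ * K l j) * A j i = 0 := by
      simp only [Finset.sum_mul]
      rw [Finset.sum_comm]
      refine Finset.sum_eq_zero fun l _ => ?_
      simp only [mul_assoc]
      rw [← Finset.mul_sum, h2, mul_zero]
    have hz2 : ∑ j, t k j * A j i = ∑ j, (v k j : ℤ) * A j i := by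
      simp only [t, sub_mul, Finset.sum_sub_distrib, hz, sub_zero]
    simp [hA]
    exact_mod_cast hz2

/-- If `X₁,…,X_m` are `η`-coplanar, then for every unit vector `θ ∈ C_X`,
`γ(θ) = ⟨θ,η⟩ ⬝ sup{h(p) : ∑ p_j X_j = θ/⟨θ,η⟩}`. -/
theorem stmt12 {s m : ℕ} (hs : 1 ≤ s) (hm : 2 ≤ m) (X : Fin m → Euc s)
    (hint : IntegralVecs X)
    (hspan : Submodule.span ℝ (Set.range X) = ⊤)
    (α : Euc s) (hα : ∀ j, 0 < ⟪X j, α⟫)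
    (η : Euc s) (hη : ∀ j, ⟪η, X j⟫ = 1)
    (θ : Euc s) (hθc : θ ∈ coneOf X) (hθ : ‖θ‖ = 1)
    (γθ : ℝ)
    (hγ : Filter.Tendsto (fun k : ℕ => Real.log (multC X ((k : ℝ) • θ)) / k)
      Filter.atTop (nhds γθ)) :
    γθ = ⟪θ, η⟫ * sSup {h : ℝ | ∃ p : Fin m → ℝ, (∀ j, 0 ≤ p j) ∧ ∑ j, p j = 1 ∧
      (∑ j, p j • X j = (⟪θ, η⟫)⁻¹ • θ) ∧ h = entropy p} := by
  obtain ⟨c0, hc0, hc0θ⟩ := id hθc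
  set a := ⟪θ, η⟫ with ha
  have hrep : ∀ c : Fin m → ℝ, ∑ j, c j • X j = θ → ∑ j, c j = a := by
    intro c hc
    rw [← inner_rep X η hη, hc, ha, real_inner_comm]
  have hapos : 0 < a := by
    have hnn : 0 ≤ a := by rw [← hrep c0 hc0θ]; exact Finset.sum_nonneg fun j _ => hc0 j
    refine lt_of_le_of_ne hnn fun h => ?_
    have h0 := (Finset.sum_eq_zero_iff_of_nonneg (fun j _ => hc0 j)).1 ((hrep c0 hc0θ).trans h.symm)
    have : θ = 0 := by
      rw [← hc0θ]
      exact Finset.sum_eq_zero fun j hj => by rw [h0 j hj, zero_smul]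
    rw [this] at hθ
    simp at hθ
  set R := ∑ j, ‖X j‖
  have hz : ∀ k : ℕ, ∃ z ∈ sgOf X, ‖z - (k:ℝ) • θ‖ ≤ R ∧ mult X z = multC X ((k:ℝ) • θ) := by
    intro k
    obtain ⟨z, hz, hd, hm⟩ := nearest X hint ((k:ℝ) • θ)
    refine ⟨z, hz, ?_, hm⟩
    rw [← dist_eq_norm, dist_comm, hd]
    exact infDist_bound X θ hθc k
  choose z hzJ hzR hzm using hz
  -- upper bound
  have hup : ∃ x : Fin m → ℝ, (∀ j, 0 ≤ x j) ∧ ∑ j, x j • X j = θ ∧ γθ ≤ GG x := by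
    choose v hv hvm using fun k => mult_upper X η hη (z k) (hzJ k)
    obtain ⟨c, φ, hφ, hc, hcθ, hlim⟩ := extract X η hη θ R v (fun k => by rw [hv]; exact hzR k)
    refine ⟨c, hc, hcθ, ?_⟩
    have hφR : Tendsto (fun k => (φ k : ℝ)) atTop atTop :=
      tendsto_natCast_atTop_atTop.comp hφ.tendsto_atTop
    have l1 := hγ.comp hφ.tendsto_atTop
    have l2 := multinomial_asymp φ hφ.tendsto_atTop (fun k => v (φ k)) c hlim
    have l3 : Tendsto (fun k => (m : ℝ) * (Real.log ((∑ j, v (φ k) j : ℕ) + 1 : ℝ) / φ k))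
        atTop (𝓝 0) := by
      rw [← mul_zero (m : ℝ)]
      refine Tendsto.const_mul _ ?_
      have hs : Tendsto (fun k => ((∑ j, v (φ k) j : ℕ) + 1 : ℝ) / φ k) atTop (𝓝 (∑ j, c j)) := by
        have e := (tendsto_finsetSum Finset.univ fun j _ => hlim j).add (hφR.const_div_atTop (1:ℝ))
        rw [add_zero] at e
        refine e.congr fun k => ?_
        push_cast
        rw [add_div, Finset.sum_div]
      have hs2 := (Real.continuousAt_log (x := ∑ j, c j) (by rw [hrep c hcθ]; exact hapos.ne')).tendsto.comp hs
      have hs3 := (hs2.mul (hφR.const_div_atTop (1:ℝ))).add (log_div_zero φ hφ.tendsto_atTop)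
      simp only [mul_zero, add_zero] at hs3
      refine hs3.congr' ?_
      filter_upwards [hφR.eventually_gt_atTop 0] with k hk
      simp only [Function.comp]
      rw [Real.log_div (by positivity) hk.ne']
      ring
    have l4 := l3.add l2
    rw [zero_add] at l4
    refine le_of_tendsto_of_tendsto l1 l4 ?_
    filter_upwards [hφR.eventually_gt_atTop 0] with k hk
    simp only [Function.comp]
    rw [← hzm]
    have hmp := Nat.multinomial_pos Finset.univ (v (φ k))
    have hpos : 0 < mult X (z (φ k)) := hmp.trans_le (mult_lower X η hη _ _ (hv _))
    have e1 : (mult X (z (φ k)) : ℝ) ≤ ((∑ j, v (φ k) j : ℕ) + 1 : ℝ) ^ m *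
      (Nat.multinomial Finset.univ (v (φ k)) : ℕ) := by exact_mod_cast hvm (φ k)
    have e2 := Real.log_le_log (by exact_mod_cast hpos) e1
    rw [Real.log_mul (by positivity) (by positivity), Real.log_pow] at e2
    rw [← mul_div_assoc, ← add_div]
    exact div_le_div_of_nonneg_right e2 hk.le
  -- lower bound
  have hlow : ∀ x : Fin m → ℝ, (∀ j, 0 ≤ x j) → ∑ j, x j • X j = θ → GG x ≤ γθ := by
    intro x hx hxθ
    choose v hv using hzJ
    obtain ⟨c, φ, hφ, hc, hcθ, hlim⟩ := extract X η hη θ R v (fun k => by rw [hv]; exact hzR k)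
    have hφR : Tendsto (fun k => (φ k : ℝ)) atTop atTop :=
      tendsto_natCast_atTop_atTop.comp hφ.tendsto_atTop
    have l1 := hγ.comp hφ.tendsto_atTop
    have hε : ∀ ε : ℝ, ε ∈ Set.Ioo (0:ℝ) 1 → GG (fun j => (1 - ε) * x j + ε * c j) ≤ γθ := by
      rintro ε ⟨h0, h1⟩
      have h1' : 0 < 1 - ε := by linarith
      obtain ⟨u, hu, hue⟩ := shift X hint φ hφ.tendsto_atTop (fun k => v (φ k)) c
        (fun j => (1 - ε) * x j + ε * c j) hlim
        (by
          simp only [add_smul, Finset.sum_add_distrib, mul_smul, ← Finset.smul_sum, hcθ, hxθ]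
          rw [← add_smul]; simp)
        (fun j => add_nonneg (mul_nonneg h1'.le (hx j)) (mul_nonneg h0.le (hc j)))
        (fun j hj => by
          have i1 := mul_nonneg h1'.le (hx j)
          have i2 := mul_nonneg h0.le (hc j)
          have i3 : ε * c j = 0 := by linarith
          exact (mul_eq_zero.1 i3).resolve_left h0.ne')
      have l2 := multinomial_asymp φ hφ.tendsto_atTop u _ hu
      refine le_of_tendsto_of_tendsto l2 l1 ?_
      filter_upwards [hφR.eventually_gt_atTop 0, hue] with k hk huk
      simp only [Function.comp]
      rw [← hzm]
      have hmp := Nat.multinomial_pos Finset.univ (u k)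
      have e := mult_lower X η hη (z (φ k)) (u k) (huk.trans (hv _))
      refine div_le_div_of_nonneg_right (Real.log_le_log (by exact_mod_cast hmp) ?_) hk.le
      exact_mod_cast e
    have hcont : Continuous fun ε : ℝ => GG (fun j => (1 - ε) * x j + ε * c j) :=
      GG_cont.comp (by fun_prop)
    have ht : Tendsto (fun ε : ℝ => GG (fun j => (1 - ε) * x j + ε * c j)) (𝓝[>] 0) (𝓝 (GG x)) := by
      have := (hcont.tendsto 0).mono_left (nhdsWithin_le_nhds (s := Set.Ioi 0))
      simpa using this
    refine le_of_tendsto ht ?_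
    filter_upwards [Ioo_mem_nhdsGT (zero_lt_one (α := ℝ))] with ε h using hε ε h
  have hlow' : ∀ h ∈ {h : ℝ | ∃ p : Fin m → ℝ, (∀ j, 0 ≤ p j) ∧ ∑ j, p j = 1 ∧
      (∑ j, p j • X j = a⁻¹ • θ) ∧ h = entropy p}, h ≤ γθ / a := by
    rintro h ⟨p, hp, hp1, hpθ, rfl⟩
    rw [le_div_iff₀ hapos, mul_comm]
    have e := GG_smul a hapos p hp1
    rw [show a * entropy p = GG (fun j => a * p j) from e.symm]
    refine hlow _ (fun j => mul_nonneg hapos.le (hp j)) ?_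
    simp only [mul_smul, ← Finset.smul_sum, hpθ]
    rw [smul_smul, mul_inv_cancel₀ hapos.ne', one_smul]
  obtain ⟨x, hx, hxθ, hxγ⟩ := hup
  have hsum : ∑ j, a⁻¹ * x j = 1 := by
    rw [← Finset.mul_sum, hrep x hxθ, inv_mul_cancel₀ hapos.ne']
  have hxmem : entropy (fun j => a⁻¹ * x j) ∈ {h : ℝ | ∃ p : Fin m → ℝ, (∀ j, 0 ≤ p j) ∧
      ∑ j, p j = 1 ∧ (∑ j, p j • X j = a⁻¹ • θ) ∧ h = entropy p} := by
    refine ⟨_, fun j => mul_nonneg (inv_nonneg.2 hapos.le) (hx j), hsum, ?_, rfl⟩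
    simp only [mul_smul, ← Finset.smul_sum, hxθ]
  apply le_antisymm
  · have e := GG_smul a hapos _ hsum
    simp only [← mul_assoc, mul_inv_cancel₀ hapos.ne', one_mul] at e
    refine hxγ.trans ?_
    refine e.le.trans ?_
    refine mul_le_mul_of_nonneg_left ?_ hapos.le
    refine le_trans (le_of_eq ?_) (le_csSup ⟨_, hlow'⟩ hxmem)
    simp [entropy]
  · have := csSup_le ⟨_, hxmem⟩ hlow'
    rw [le_div_iff₀ hapos] at this
    linarith
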